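/- The relation of almost equality on recursively enumerable sets, E e i ↔ W_e =* W_i, is a Σ⁰₃-complete equivalence relation: (a) E is an equivalence relation on ℕ and is Σ⁰₃; and (b) for every Σ⁰₃ equivalence relation F on ℕ there is a total computable f : ℕ → ℕ such that for all i, j: F i j ↔ W_{f i} =* W_{f j}. -/

import Mathlib

/-- The `e`-th computably enumerable set: the domain of the `e`-th partial
computable function under the standard numbering. -/
def W (e : ℕ) : Set ℕ :=
  {n | ((Denumerable.ofNat Nat.Partrec.Code e).eval n).Dom}

/-- A binary relation on ℕ is Σ⁰₃. -/
def Sigma03Rel (P : ℕ → ℕ → Prop) : Prop :=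
  ∃ M : ℕ → ℕ → ℕ → ℕ → ℕ → Bool,
    Computable (fun p : ℕ × ℕ × ℕ × ℕ × ℕ => M p.1 p.2.1 p.2.2.1 p.2.2.2.1 p.2.2.2.2) ∧
    ∀ x y, P x y ↔ ∃ a, ∀ b, ∃ c, M x y a b c = true

/-- `A` and `B` are almost equal: their symmetric difference is finite. -/
def AlmostEqual (A B : Set ℕ) : Prop := ((A \ B) ∪ (B \ A)).Finite

open Encodable Nat.Partrec

theorem Computable.and {α : Type*} [Primcodable α] {f g : α → Bool} (hf : Computable f)
    (hg : Computable g) : Computable fun a => f a && g a :=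
  Primrec.and.to_comp.comp hf hg

theorem Computable.or {α : Type*} [Primcodable α] {f g : α → Bool} (hf : Computable f)
    (hg : Computable g) : Computable fun a => f a || g a :=
  Primrec.or.to_comp.comp hf hg

theorem Computable.not {α : Type*} [Primcodable α] {f : α → Bool} (hf : Computable f) :
    Computable fun a => !f a :=
  Primrec.not.to_comp.comp hf

theorem Computable.decide_eq {α β : Type*} [Primcodable α] [Primcodable β] [DecidableEq β]
    {f g : α → β} (hf : Computable f) (hg : Computable g) : Computable fun a => decide (f a = g a) :=
  Primrec.eq.decide.to_comp.comp hf hg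

theorem Computable.decide_lt {α : Type*} [Primcodable α] {f g : α → ℕ} (hf : Computable f)
    (hg : Computable g) : Computable fun a => decide (f a < g a) :=
  Primrec.nat_lt.decide.to_comp.comp hf hg

/-- Bounded universal quantification preserves computability. -/
theorem Computable.decide_ball_lt {α : Type*} [Primcodable α] {p : α → ℕ → Bool} {g : α → ℕ}
    (hp : Computable₂ p) (hg : Computable g) :
    Computable fun a => decide (∀ b < g a, p a b = true) := by
  have h : Computable fun a =>
      (Nat.rec true (fun b ih => p a b && ih) (g a) : Bool) :=
    Computable.nat_rec hg (Computable.const true)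
      (Computable.and (hp.comp Computable.fst (Computable.fst.comp Computable.snd))
        (Computable.snd.comp Computable.snd)).to₂
  refine h.of_eq fun a => ?_
  induction g a with
  | zero => simp
  | succ n ih =>
    simp only [ih]
    rw [Bool.eq_iff_iff]
    simp only [Bool.and_eq_true, decide_eq_true_eq, Nat.forall_lt_succ_right, and_comm]

/-- A uniformly c.e. sequence of subsets of `α` is, up to coding, a computable sequence of `W`s. -/
theorem exists_computable_W_eq {α β : Type*} [Primcodable α] [Primcodable β]
    {T : ℕ → α → β → Bool} (hT : Computable fun p : ℕ × α × β => T p.1 p.2.1 p.2.2) :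
    ∃ f : ℕ → ℕ, Computable f ∧ ∀ j, W (f j) = encode '' {x | ∃ t, T j x t = true} := by
  let g : ℕ × ℕ → ℕ → Option Unit := fun q m =>
    (decode (α := α) q.2).bind fun x => (decode (α := β) m).bind fun t =>
      bif decide (encode x = q.2) && T q.1 x t then some () else none
  have hg : Computable₂ g := by
    have hj : Computable fun p : (((ℕ × ℕ) × ℕ) × α) × β => p.1.1.1.1 :=
      Computable.fst.comp (Computable.fst.comp (Computable.fst.comp Computable.fst))
    have hx : Computable fun p : (((ℕ × ℕ) × ℕ) × α) × β => p.1.2 :=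
      Computable.snd.comp Computable.fst
    have ht : Computable fun p : (((ℕ × ℕ) × ℕ) × α) × β => (p.1.1.1.1, p.1.2, p.2) :=
      hj.pair (hx.pair Computable.snd)
    have hTt := hT.comp ht
    have hn' : Computable fun p : (((ℕ × ℕ) × ℕ) × α) × β => p.1.1.1.2 :=
      Computable.snd.comp (Computable.fst.comp (Computable.fst.comp Computable.fst))
    have hxn := (Computable.encode.comp hx).decide_eq hn'
    have hcond : Computable₂ fun (p : ((ℕ × ℕ) × ℕ) × α) (t : β) =>
        bif decide (encode p.2 = p.1.1.2) && T p.1.1.1 p.2 t then some () else none :=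
      Computable.cond (hxn.and hTt) (Computable.const (some ())) (Computable.const none)
    have hm : Computable fun p : ((ℕ × ℕ) × ℕ) × α => decode (α := β) p.1.2 :=
      Computable.decode.comp (Computable.snd.comp Computable.fst)
    have hn : Computable fun p : (ℕ × ℕ) × ℕ => decode (α := α) p.1.2 :=
      Computable.decode.comp (Computable.snd.comp Computable.fst)
    have hbind : Computable₂ fun (p : (ℕ × ℕ) × ℕ) (x : α) =>
        (decode (α := β) p.2).bind fun t =>
          bif decide (encode x = p.1.2) && T p.1.1 x t then some () else none :=
      Computable.option_bind hm hcond
    exact Computable.option_bind hn hbind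
  have hr : Partrec fun q : ℕ × ℕ => Nat.rfindOpt (g q) := Partrec.rfindOpt hg
  have hn : Nat.Partrec fun n => (Nat.rfindOpt (g n.unpair)).map encode :=
    Partrec.nat_iff.1 ((hr.comp Computable.unpair).map (Computable.encode.comp Computable.snd).to₂)
  obtain ⟨c, hc⟩ := Code.exists_code.1 hn
  refine ⟨fun j => encode (c.curry j), Computable.encode.comp
    (Code.primrec₂_curry.to_comp.comp (Computable.const c) Computable.id), fun j => ?_⟩
  ext n
  have : n ∈ W (encode (c.curry j)) ↔ (Nat.rfindOpt (g (j, n))).Dom := by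
    simp [W, Code.eval_curry, hc]
  rw [this, Nat.rfindOpt_dom]
  simp only [g, Option.mem_def, Option.bind_eq_some_iff, Set.mem_image, Set.mem_ofPred_eq]
  constructor
  · rintro ⟨m, u, x, -, t, -, hxt⟩
    cases h : decide (encode x = n) && T j x t
    · simp [h] at hxt
    · rw [Bool.and_eq_true, decide_eq_true_eq] at h
      exact ⟨x, ⟨t, h.2⟩, h.1⟩
  · rintro ⟨x, ⟨t, ht⟩, rfl⟩
    exact ⟨encode t, (), x, encodek x, t, encodek t, by simp [ht]⟩

theorem AlmostEqual.equivalence : Equivalence AlmostEqual where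
  refl A := by simp [AlmostEqual]
  symm h := by rwa [AlmostEqual, Set.union_comm]
  trans {A B C} h₁ h₂ := (h₁.union h₂).subset fun x => by
    simp only [Set.mem_union, Set.mem_sdiff]; tauto

theorem almostEqual_iff_exists_forall_ge {A B : Set ℕ} :
    AlmostEqual A B ↔ ∃ a, ∀ x ≥ a, x ∈ A ↔ x ∈ B := by
  constructor
  · intro h
    obtain ⟨a, ha⟩ := h.bddAbove
    refine ⟨a + 1, fun x hx => ?_⟩
    by_contra hne
    have : x ≤ a := ha (by simp only [Set.mem_union, Set.mem_sdiff]; tauto)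
    omega
  · rintro ⟨a, ha⟩
    refine (Set.finite_lt_nat a).subset fun x hx => ?_
    by_contra hxa
    have := ha x (not_lt.1 hxa)
    simp only [Set.mem_union, Set.mem_sdiff] at hx
    tauto

theorem almostEqual_image_iff {α : Type*} {e : α → ℕ} (he : Function.Injective e) {A B : Set α} :
    AlmostEqual (e '' A) (e '' B) ↔ ((A \ B) ∪ (B \ A)).Finite := by
  rw [AlmostEqual, ← Set.image_sdiff he, ← Set.image_sdiff he, ← Set.image_union,
    Set.finite_image_iff he.injOn]

/-- The stage-`s` approximation to membership in `W e`. -/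
def memWAt (s e x : ℕ) : Bool := (Code.evaln s (Denumerable.ofNat Code e) x).isSome

theorem mem_W_iff_exists_memWAt {e x : ℕ} : x ∈ W e ↔ ∃ s, memWAt s e x = true := by
  simp only [W, Set.mem_ofPred_eq, Part.dom_iff_mem, Code.evaln_complete, memWAt,
    Option.isSome_iff_exists, Option.mem_def]
  exact exists_comm

theorem computable_memWAt {α : Type*} [Primcodable α] {s e x : α → ℕ} (hs : Computable s)
    (he : Computable e) (hx : Computable x) : Computable fun a => memWAt (s a) (e a) (x a) :=
  Primrec.option_isSome.to_comp.comp <| Code.primrec_evaln.to_comp.comp <|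
    (hs.pair ((Computable.ofNat Code).comp he)).pair hx

theorem sigma03Rel_almostEqual_W : Sigma03Rel fun e i => AlmostEqual (W e) (W i) := by
  refine ⟨fun e i a b c => decide (b.unpair.1 < a) ||
    ((!memWAt b.unpair.2 e b.unpair.1 || memWAt c i b.unpair.1) &&
      (!memWAt b.unpair.2 i b.unpair.1 || memWAt c e b.unpair.1)), ?_, fun e i => ?_⟩
  · have he : Computable fun p : ℕ × ℕ × ℕ × ℕ × ℕ => p.1 := Computable.fst
    have hi : Computable fun p : ℕ × ℕ × ℕ × ℕ × ℕ => p.2.1 := Computable.fst.comp Computable.snd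
    have hr : Computable fun p : ℕ × ℕ × ℕ × ℕ × ℕ => p.2.2 := Computable.snd.comp Computable.snd
    have ha : Computable fun p : ℕ × ℕ × ℕ × ℕ × ℕ => p.2.2.1 := Computable.fst.comp hr
    have hb : Computable fun p : ℕ × ℕ × ℕ × ℕ × ℕ => p.2.2.2.1.unpair :=
      Computable.unpair.comp (Computable.fst.comp (Computable.snd.comp hr))
    have hx : Computable fun p : ℕ × ℕ × ℕ × ℕ × ℕ => p.2.2.2.1.unpair.1 := Computable.fst.comp hb
    have hs : Computable fun p : ℕ × ℕ × ℕ × ℕ × ℕ => p.2.2.2.1.unpair.2 := Computable.snd.comp hb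
    have hc : Computable fun p : ℕ × ℕ × ℕ × ℕ × ℕ => p.2.2.2.2 :=
      Computable.snd.comp (Computable.snd.comp hr)
    exact (hx.decide_lt ha).or <|
      ((computable_memWAt hs he hx).not.or (computable_memWAt hc hi hx)).and
        ((computable_memWAt hs hi hx).not.or (computable_memWAt hc he hx))
  · beta_reduce
    rw [almostEqual_iff_exists_forall_ge]
    refine exists_congr fun a => ⟨fun h b => ?_, fun h x hx => ?_⟩
    · rcases lt_or_ge b.unpair.1 a with hlt | hge
      · simp [hlt]
      · have hiff := h _ hge
        simp only [mem_W_iff_exists_memWAt] at hiff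
        cases h₁ : memWAt b.unpair.2 e b.unpair.1 <;> cases h₂ : memWAt b.unpair.2 i b.unpair.1
        · simp
        · exact (hiff.2 ⟨_, h₂⟩).imp fun c hc => by simp [hc]
        · exact (hiff.1 ⟨_, h₁⟩).imp fun c hc => by simp [hc]
        · exact ⟨b.unpair.2, by simp [h₁, h₂]⟩
    · simp only [mem_W_iff_exists_memWAt]
      constructor <;> rintro ⟨s, hs⟩ <;> obtain ⟨c, hc⟩ := h (Nat.pair x s) <;>
        simp [hs, hx.not_gt] at hc
      · exact ⟨c, hc.1⟩
      · exact ⟨c, hc.2⟩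

/-- The witness `t` confirms up to level `k` that the finite set coded by `σ` is not closed, within
`{0, …, σ.length - 1}`, under the relation `∃ a < σ.length, ∀ b, ∃ c, M x y a b c`. -/
def confirms (M : ℕ → ℕ → ℕ → ℕ → ℕ → Bool) (σ : List Bool) (k : ℕ)
    (t : ℕ × ℕ × ℕ × List ℕ) : Bool :=
  decide (σ[t.1]? = some true) && decide (σ[t.2.1]? = some false) &&
    decide (t.2.2.1 < σ.length) &&
    decide (∀ b < k, M t.1 t.2.1 t.2.2.1 b (t.2.2.2.getD b 0) = true)

/-- `NotClosed M σ k` holds for all `k` iff the set coded by `σ` is not closed. -/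
def NotClosed (M : ℕ → ℕ → ℕ → ℕ → ℕ → Bool) (σ : List Bool) (k : ℕ) : Prop :=
  k = 0 ∨ ∃ t, confirms M σ k t = true

theorem notClosed_iff_of_ne_zero {M : ℕ → ℕ → ℕ → ℕ → ℕ → Bool} {σ : List Bool} {k : ℕ} (hk : k ≠ 0) :
    NotClosed M σ k ↔ ∃ x y a, σ[x]? = some true ∧ σ[y]? = some false ∧ a < σ.length ∧
      ∀ b < k, ∃ c, M x y a b c = true := by
  simp only [NotClosed, hk, false_or, confirms, Prod.exists, Bool.and_eq_true, decide_eq_true_eq]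
  refine exists_congr fun x => exists_congr fun y => exists_congr fun a => ⟨?_, ?_⟩
  · rintro ⟨w, ⟨⟨hx, hy⟩, ha⟩, h⟩
    exact ⟨hx, hy, ha, fun b hb => ⟨_, h b hb⟩⟩
  · rintro ⟨hx, hy, ha, h⟩
    choose! c hc using h
    refine ⟨(List.range k).map c, ⟨⟨hx, hy⟩, ha⟩, fun b hb => ?_⟩
    simpa [List.getD, hb] using hc b hb

theorem notClosed_antitone (M : ℕ → ℕ → ℕ → ℕ → ℕ → Bool) (σ : List Bool) :
    Antitone (NotClosed M σ) := by
  intro k l hkl h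
  rcases eq_or_ne k 0 with rfl | hk
  · exact Or.inl rfl
  · rw [notClosed_iff_of_ne_zero (by omega)] at h
    rw [notClosed_iff_of_ne_zero hk]
    obtain ⟨x, y, a, hx, hy, ha, h⟩ := h
    exact ⟨x, y, a, hx, hy, ha, fun b hb => h b (hb.trans_le hkl)⟩

theorem exists_of_forall_notClosed {M : ℕ → ℕ → ℕ → ℕ → ℕ → Bool} {σ : List Bool}
    (h : ∀ k, NotClosed M σ k) :
    ∃ x y a, σ[x]? = some true ∧ σ[y]? = some false ∧ ∀ b, ∃ c, M x y a b c = true := by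
  by_contra! hne
  have hfail (p : Fin σ.length × Fin σ.length × Fin σ.length) :
      ∃ b, σ[p.1]? = some true → σ[p.2.1]? = some false →
        ∀ c, M p.1 p.2.1 p.2.2 b c ≠ true := by
    by_cases hp : σ[p.1]? = some true ∧ σ[p.2.1]? = some false
    · obtain ⟨b, hb⟩ := hne _ _ p.2.2 hp.1 hp.2
      exact ⟨b, fun _ _ => hb⟩
    · exact ⟨0, fun h₁ h₂ => absurd ⟨h₁, h₂⟩ hp⟩
  choose B hB using hfail
  obtain ⟨x, y, a, hx, hy, ha, hc⟩ :=
    (notClosed_iff_of_ne_zero (Nat.succ_ne_zero _)).1 (h (Finset.univ.sup B + 1))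
  obtain ⟨hx', -⟩ := List.getElem?_eq_some_iff.1 hx
  obtain ⟨hy', -⟩ := List.getElem?_eq_some_iff.1 hy
  let p : Fin σ.length × Fin σ.length × Fin σ.length := (⟨x, hx'⟩, ⟨y, hy'⟩, ⟨a, ha⟩)
  obtain ⟨c, hc⟩ := hc (B p) (Nat.lt_succ_of_le (Finset.le_sup (Finset.mem_univ p)))
  exact hB p hx hy c hc

/-- The column of `σ` in the `j`-th set: it is everything if the set coded by `σ` is not closed;
otherwise it is finite, and its size tells whether `j` belongs to the set coded by `σ`. -/
def columns (M : ℕ → ℕ → ℕ → ℕ → ℕ → Bool) (j : ℕ) : Set (List Bool × ℕ) :=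
  {p | NotClosed M p.1 (p.2 + 1) ∨ p.1[j]? = some true ∧ NotClosed M p.1 p.2}

theorem mem_columns_diff_iff {M : ℕ → ℕ → ℕ → ℕ → ℕ → Bool} {i j : ℕ} {σ : List Bool} {k : ℕ} :
    (σ, k) ∈ columns M i \ columns M j ↔ σ[i]? = some true ∧ σ[j]? ≠ some true ∧
      NotClosed M σ k ∧ ¬ NotClosed M σ (k + 1) := by
  simp only [columns, Set.mem_sdiff, Set.mem_ofPred_eq]
  tauto

theorem finite_columns_diff {M : ℕ → ℕ → ℕ → ℕ → ℕ → Bool} {i j : ℕ}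
    (h : ∃ a, ∀ b, ∃ c, M i j a b c = true) : (columns M i \ columns M j).Finite := by
  obtain ⟨a, ha⟩ := h
  refine Set.Finite.of_finite_fibers Prod.fst
    ((List.finite_length_lt Bool (max j a + 1)).subset ?_) fun σ _ => ?_
  · rintro _ ⟨⟨σ, k⟩, hp, rfl⟩
    obtain ⟨hi, hj, -, hk⟩ := mem_columns_diff_iff.1 hp
    by_contra hlen
    simp only [Set.mem_ofPred_eq, not_lt] at hlen
    have hjl : j < σ.length := by omega
    refine hk ((notClosed_iff_of_ne_zero k.succ_ne_zero).2
      ⟨i, j, a, hi, ?_, by omega, fun b _ => ha b⟩)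
    rw [List.getElem?_eq_getElem hjl] at hj ⊢
    simpa using hj
  · refine Set.Subsingleton.finite ?_
    rintro ⟨τ, k⟩ ⟨hk, rfl⟩ ⟨τ', l⟩ ⟨hl, h'⟩
    obtain rfl : τ' = τ := h'
    obtain ⟨-, -, hk₁, hk₂⟩ := mem_columns_diff_iff.1 hk
    obtain ⟨-, -, hl₁, hl₂⟩ := mem_columns_diff_iff.1 hl
    have h₁ : ¬ k + 1 ≤ l := fun hle => hk₂ (notClosed_antitone M _ hle hl₁)
    have h₂ : ¬ l + 1 ≤ k := fun hle => hl₂ (notClosed_antitone M _ hle hk₁)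
    simp only [Prod.mk.injEq, true_and]
    omega

theorem infinite_columns_diff {M : ℕ → ℕ → ℕ → ℕ → ℕ → Bool} {F : ℕ → ℕ → Prop}
    (hF : Equivalence F) (hM : ∀ x y, F x y ↔ ∃ a, ∀ b, ∃ c, M x y a b c = true) {i j : ℕ}
    (hij : ¬ F i j) : (columns M i \ columns M j).Infinite := by
  classical
  let σ (n : ℕ) : List Bool := (List.range n).map fun x => decide (F i x)
  have hσ {n x : ℕ} {v : Bool} : (σ n)[x]? = some v ↔ x < n ∧ decide (F i x) = v := by
    simp [σ, List.getElem?_eq_some_iff]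
  have hfail (n : ℕ) : ∃ k, NotClosed M (σ n) k ∧ ¬ NotClosed M (σ n) (k + 1) := by
    by_contra! hstep
    have hall (k : ℕ) : NotClosed M (σ n) k := by
      induction k with
      | zero => exact Or.inl rfl
      | succ k ih => exact hstep k ih
    obtain ⟨x, y, a, hx, hy, h⟩ := exists_of_forall_notClosed hall
    have hix : F i x := by simpa using (hσ.1 hx).2
    have hiy : ¬ F i y := by simpa using (hσ.1 hy).2
    exact hiy (hF.trans hix ((hM x y).2 ⟨a, h⟩))
  choose k hk₁ hk₂ using hfail
  refine Set.infinite_of_injective_forall_mem (f := fun n => (σ (i + 1 + n), k (i + 1 + n)))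
    (fun m n hmn => ?_) fun n => mem_columns_diff_iff.2 ⟨?_, ?_, hk₁ _, hk₂ _⟩
  · simpa [σ] using congrArg (fun p : List Bool × ℕ => p.1.length) hmn
  · exact hσ.2 ⟨by omega, by simpa using hF.refl i⟩
  · intro h
    exact hij (by simpa using (hσ.1 h).2)

theorem computable_confirms {M : ℕ → ℕ → ℕ → ℕ → ℕ → Bool}
    (hM : Computable fun p : ℕ × ℕ × ℕ × ℕ × ℕ => M p.1 p.2.1 p.2.2.1 p.2.2.2.1 p.2.2.2.2)
    {α : Type*} [Primcodable α] {σ : α → List Bool} {k : α → ℕ} {t : α → ℕ × ℕ × ℕ × List ℕ}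
    (hσ : Computable σ) (hk : Computable k) (ht : Computable t) :
    Computable fun p => confirms M (σ p) (k p) (t p) := by
  have hx : Computable fun p => (t p).1 := Computable.fst.comp ht
  have hy : Computable fun p => (t p).2.1 := Computable.fst.comp (Computable.snd.comp ht)
  have haw : Computable fun p => (t p).2.2 := Computable.snd.comp (Computable.snd.comp ht)
  have ha : Computable fun p => (t p).2.2.1 := Computable.fst.comp haw
  have hw : Computable fun p => (t p).2.2.2 := Computable.snd.comp haw
  have hwb : Computable fun q : α × ℕ => (t q.1).2.2.2.getD q.2 0 :=
    (Primrec.list_getD 0).to_comp.comp (hw.comp Computable.fst) Computable.snd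
  have hball : Computable₂ fun p b =>
      M (t p).1 (t p).2.1 (t p).2.2.1 b ((t p).2.2.2.getD b 0) :=
    hM.comp ((hx.comp Computable.fst).pair ((hy.comp Computable.fst).pair
      ((ha.comp Computable.fst).pair (Computable.snd.pair hwb))))
  have hσx : Computable fun p => (σ p)[(t p).1]? := Computable.list_getElem?.comp hσ hx
  have hσy : Computable fun p => (σ p)[(t p).2.1]? := Computable.list_getElem?.comp hσ hy
  have hlen : Computable fun p => (σ p).length := Computable.list_length.comp hσ
  exact (((hσx.decide_eq (Computable.const _)).and (hσy.decide_eq (Computable.const _))).and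
    (ha.decide_lt hlen)).and (Computable.decide_ball_lt hball hk)

theorem exists_computable_W_eq_columns {M : ℕ → ℕ → ℕ → ℕ → ℕ → Bool}
    (hM : Computable fun p : ℕ × ℕ × ℕ × ℕ × ℕ => M p.1 p.2.1 p.2.2.1 p.2.2.2.1 p.2.2.2.2) :
    ∃ f : ℕ → ℕ, Computable f ∧ ∀ j, W (f j) = encode '' columns M j := by
  let T (j : ℕ) (p : List Bool × ℕ) (t : ℕ × ℕ × ℕ × List ℕ) : Bool :=
    confirms M p.1 (p.2 + 1) t ||
      (decide (p.1[j]? = some true) && (decide (p.2 = 0) || confirms M p.1 p.2 t))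
  have hT : Computable fun p : ℕ × (List Bool × ℕ) × ℕ × ℕ × ℕ × List ℕ => T p.1 p.2.1 p.2.2 := by
    let P := ℕ × (List Bool × ℕ) × ℕ × ℕ × ℕ × List ℕ
    have hp : Computable fun p : P => p.2.1 := Computable.fst.comp Computable.snd
    have ht : Computable fun p : P => p.2.2 := Computable.snd.comp Computable.snd
    have hσ : Computable fun p : P => p.2.1.1 := Computable.fst.comp hp
    have hk : Computable fun p : P => p.2.1.2 := Computable.snd.comp hp
    have hk' : Computable fun p : P => p.2.1.2 + 1 := Computable.succ.comp hk
    have hσj : Computable fun p : P => p.2.1.1[p.1]? :=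
      Computable.list_getElem?.comp hσ Computable.fst
    exact (computable_confirms hM hσ hk' ht).or
      ((hσj.decide_eq (Computable.const _)).and
        ((hk.decide_eq (Computable.const _)).or (computable_confirms hM hσ hk ht)))
  obtain ⟨f, hf, hW⟩ := exists_computable_W_eq hT
  refine ⟨f, hf, fun j => (hW j).trans (congrArg _ (Set.ext fun p => ?_))⟩
  simp only [T, columns, NotClosed, Set.mem_ofPred_eq, Bool.or_eq_true, Bool.and_eq_true,
    decide_eq_true_eq, exists_or, exists_and_left, exists_const, Nat.succ_ne_zero, false_or]

/-- Almost equality of r.e. sets is a Σ⁰₃-complete equivalence relation. -/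
theorem stmt_15 :
    Equivalence (fun e i => AlmostEqual (W e) (W i)) ∧
    Sigma03Rel (fun e i => AlmostEqual (W e) (W i)) ∧
    ∀ F : ℕ → ℕ → Prop, Equivalence F → Sigma03Rel F →
      ∃ f : ℕ → ℕ, Computable f ∧
        ∀ i j, F i j ↔ AlmostEqual (W (f i)) (W (f j)) := by
  refine ⟨AlmostEqual.equivalence.comap W, sigma03Rel_almostEqual_W, ?_⟩
  rintro F hF ⟨M, hM, hFM⟩
  obtain ⟨f, hf, hW⟩ := exists_computable_W_eq_columns hM
  refine ⟨f, hf, fun i j => ?_⟩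
  rw [hW, hW, almostEqual_image_iff encode_injective]
  refine ⟨fun hij => ?_, fun hfin => ?_⟩
  · exact (finite_columns_diff ((hFM i j).1 hij)).union
      (finite_columns_diff ((hFM j i).1 (hF.symm hij)))
  · by_contra hij
    exact infinite_columns_diff hF hFM hij (hfin.subset Set.subset_union_left)
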